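/- Let γ > 0, v > 0, r > −1, and let m, β, μ be real numbers. For each price p, let λᵘ(p) be the unique maximizer of λ ↦ ∫ -exp(-2γ(1 + r + λ(x − p + (1 − p) r))) d(gaussianReal m v)(x) and let λᵇ(p) be the unique maximizer of λ ↦ ∫ -exp(-2γ(1 + r + λ(x − p + (1 − p) r))) d(gaussianReal (m + β) v)(x). Then there exists a unique price p* satisfying the market-clearing condition (1 − μ) λᵘ(p*) + μ λᵇ(p*) = 1, and it is given by p* = (r + m − 2 γ v + μ β) / (1 + r). -/

import Mathlib

open MeasureTheory ProbabilityTheory Real NNReal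

/-- Expected CARA utility `-exp (-2γ(a + l(x + b)))` under a Gaussian belief. -/
lemma integral_neg_exp_cara_gaussianReal (γ a b l m : ℝ) (v : ℝ≥0) :
    ∫ x, -Real.exp (-2 * γ * (a + l * (x + b))) ∂(gaussianReal m v)
      = -Real.exp (-2 * γ * a - 2 * γ * l * (m + b) + 2 * γ ^ 2 * v * l ^ 2) := by
  have hmgf : ∫ x, Real.exp (-2 * γ * l * x) ∂(gaussianReal m v)
      = Real.exp (m * (-2 * γ * l) + v * (-2 * γ * l) ^ 2 / 2) :=
    congrFun (mgf_fun_id_gaussianReal (μ := m) (v := v)) (-2 * γ * l)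
  have hsplit (x : ℝ) : Real.exp (-2 * γ * (a + l * (x + b)))
      = Real.exp (-2 * γ * (a + l * b)) * Real.exp (-2 * γ * l * x) := by
    rw [← Real.exp_add]
    ring_nf
  simp_rw [integral_neg, hsplit]
  rw [integral_const_mul, hmgf, ← Real.exp_add]
  ring_nf

/-- A strict maximizer of expected CARA utility under a Gaussian belief is the mean excess
return divided by `2γv`. -/
lemma two_mul_mul_eq_of_isMax_cara {γ r p m L : ℝ} {v : ℝ≥0} (hγ : 0 < γ) (hv : 0 < v)
    (hL : ∀ l : ℝ, l ≠ L →
      (∫ x, -Real.exp (-2 * γ * (1 + r + l * (x - p + (1 - p) * r))) ∂(gaussianReal m v))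
        < ∫ x, -Real.exp (-2 * γ * (1 + r + L * (x - p + (1 - p) * r)))
            ∂(gaussianReal m v)) :
    2 * γ * v * L = m - p + (1 - p) * r := by
  have hv' : (0 : ℝ) < v := hv
  by_contra hne
  set d := m - p + (1 - p) * r with hd
  have hl : d / (2 * γ * v) ≠ L := by
    rintro rfl
    exact hne (by field_simp)
  have hlt := hL _ hl
  have hassoc (x : ℝ) : x - p + (1 - p) * r = x + (-p + (1 - p) * r) := by ring
  simp_rw [hassoc, integral_neg_exp_cara_gaussianReal] at hlt
  rw [← hassoc, ← hd, neg_lt_neg_iff, Real.exp_lt_exp] at hlt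
  obtain ⟨k, hk⟩ : ∃ k, k = d / (2 * γ * v) := ⟨_, rfl⟩
  have hdk : d = 2 * γ * v * k := by
    rw [hk]
    field_simp
  rw [← hk, hdk] at hlt
  have : 0 ≤ 2 * γ ^ 2 * v * (L - k) ^ 2 := by positivity
  linarith

/-- If for each price `p`, `λᵘ p` is the unique maximizer of the unbiased investor's
expected CARA utility and `λᵇ p` is the unique maximizer of the biased investor's
expected CARA utility, then there is a unique market-clearing price, given by
`p* = (r + m − 2 γ v + μ β) / (1 + r)`. -/
theorem equilibrium_price_from_expected_utility (γ : ℝ) (hγ : 0 < γ) (v : ℝ≥0) (hv : 0 < v)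
    (r : ℝ) (hr : -1 < r) (m β μ : ℝ) (lu lb : ℝ → ℝ)
    (hlu : ∀ p : ℝ, ∀ l : ℝ, l ≠ lu p →
      (∫ x, -Real.exp (-2 * γ * (1 + r + l * (x - p + (1 - p) * r))) ∂(gaussianReal m v))
        < ∫ x, -Real.exp (-2 * γ * (1 + r + lu p * (x - p + (1 - p) * r)))
            ∂(gaussianReal m v))
    (hlb : ∀ p : ℝ, ∀ l : ℝ, l ≠ lb p →
      (∫ x, -Real.exp (-2 * γ * (1 + r + l * (x - p + (1 - p) * r)))
          ∂(gaussianReal (m + β) v))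
        < ∫ x, -Real.exp (-2 * γ * (1 + r + lb p * (x - p + (1 - p) * r)))
            ∂(gaussianReal (m + β) v)) :
    ∀ p : ℝ, (1 - μ) * lu p + μ * lb p = 1
      ↔ p = (r + m - 2 * γ * (v : ℝ) + μ * β) / (1 + r) := by
  intro p
  have hv' : (0 : ℝ) < v := hv
  have hu := two_mul_mul_eq_of_isMax_cara hγ hv (hlu p)
  have hb := two_mul_mul_eq_of_isMax_cara hγ hv (hlb p)
  have hdemand : 2 * γ * v * ((1 - μ) * lu p + μ * lb p)
      = m - p + (1 - p) * r + μ * β := by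
    linear_combination (1 - μ) * hu + μ * hb
  rw [eq_div_iff (by linarith : (0 : ℝ) < 1 + r).ne']
  constructor
  · intro h
    rw [h] at hdemand
    linarith
  · intro h
    have hne : 2 * γ * (v : ℝ) ≠ 0 := by positivity
    apply mul_left_cancel₀ hne
    linarith
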